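/- Let θ be a real number, let G₁ and G₂ be disjoint θ-super positive graphs, and let S₁ and S₂ be nonempty θ-barrier sets of G₁ and G₂ respectively. Let G be the graph obtained from the disjoint union G₁ ∪ G₂ by adding edges e₁, e₂, …, e_m, where each e_j has one endpoint in S₁ and the other endpoint in S₂. Then G is θ-super positive. -/

import Mathlib

open Polynomial

namespace MatchPoly

variable {V : Type*}

/-- The number of `r`-matchings in `G`: sets of `r` edges, no two sharing a vertex. -/
noncomputable def numMatchings (G : SimpleGraph V) (r : ℕ) : ℕ :=
  Nat.card {M : Finset (Sym2 V) // M.card = r ∧ (M : Set (Sym2 V)) ⊆ G.edgeSet ∧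
    (M : Set (Sym2 V)).Pairwise fun e f => ∀ v : V, v ∈ e → v ∉ f}

/-- The matching polynomial `μ(G,x) = ∑ (-1)^r p(G,r) x^(n-2r)`. -/
noncomputable def matchingPoly (G : SimpleGraph V) : Polynomial ℝ :=
  ∑ r ∈ Finset.range (Nat.card V + 1),
    Polynomial.C ((-1 : ℝ) ^ r * (numMatchings G r : ℝ)) *
      (Polynomial.X : Polynomial ℝ) ^ (Nat.card V - 2 * r)

/-- `mult θ G`: the multiplicity of `θ` as a root of `μ(G,x)`. -/
noncomputable def mult (θ : ℝ) (G : SimpleGraph V) : ℕ :=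
  (matchingPoly G).rootMultiplicity θ

/-- `G \ X`: the induced subgraph on the complement of the vertex set `X`. -/
def deleteSet (G : SimpleGraph V) (X : Set V) : SimpleGraph ↥(Xᶜ) :=
  G.induce (Xᶜ)

/-- `G \ v`: delete a single vertex. -/
def deleteVert (G : SimpleGraph V) (v : V) : SimpleGraph ↥({v}ᶜ : Set V) :=
  G.induce ({v}ᶜ : Set V)

/-- `u` is θ-essential: `mult(θ, G\u) = mult(θ,G) - 1`. -/
def IsEssential (θ : ℝ) (G : SimpleGraph V) (u : V) : Prop :=
  mult θ (deleteVert G u) + 1 = mult θ G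

/-- `u` is θ-neutral: `mult(θ, G\u) = mult(θ,G)`. -/
def IsNeutral (θ : ℝ) (G : SimpleGraph V) (u : V) : Prop :=
  mult θ (deleteVert G u) = mult θ G

/-- `u` is θ-positive: `mult(θ, G\u) = mult(θ,G) + 1`. -/
def IsPositive (θ : ℝ) (G : SimpleGraph V) (u : V) : Prop :=
  mult θ (deleteVert G u) = mult θ G + 1

/-- `u` is θ-special: not θ-essential but adjacent to a θ-essential vertex. -/
def IsSpecial (θ : ℝ) (G : SimpleGraph V) (u : V) : Prop :=
  ¬ IsEssential θ G u ∧ ∃ w : V, G.Adj u w ∧ IsEssential θ G w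

/-- `A_θ(G)`: the set of θ-special vertices. -/
def specialSet (θ : ℝ) (G : SimpleGraph V) : Set V := {u | IsSpecial θ G u}

/-- `N_θ(G)`: the set of θ-neutral vertices. -/
def neutralSet (θ : ℝ) (G : SimpleGraph V) : Set V := {u | IsNeutral θ G u}

/-- `P_θ(G)`: the set of θ-positive vertices that are not θ-special. -/
def positiveSet (θ : ℝ) (G : SimpleGraph V) : Set V :=
  {u | IsPositive θ G u ∧ ¬ IsSpecial θ G u}

/-- `G` is θ-super positive: `mult(θ,G) = 0` and `mult(θ,G\v) = 1` for every vertex `v`. -/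
def IsSuperPositive (θ : ℝ) (G : SimpleGraph V) : Prop :=
  mult θ G = 0 ∧ ∀ v : V, mult θ (deleteVert G v) = 1

/-- `G` is θ-elementary: θ-super positive and `P_θ(G\v) = ∅` for every vertex `v`. -/
def IsElementary (θ : ℝ) (G : SimpleGraph V) : Prop :=
  IsSuperPositive θ G ∧ ∀ v : V, positiveSet θ (deleteVert G v) = ∅

/-- `G` is θ-critical: every vertex is θ-essential and `mult(θ,G) = 1`. -/
def IsCritical (θ : ℝ) (G : SimpleGraph V) : Prop :=
  (∀ v : V, IsEssential θ G v) ∧ mult θ G = 1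

/-- `c_θ(G)`: the number of θ-critical connected components of `G`. -/
noncomputable def numCritComponents (θ : ℝ) (G : SimpleGraph V) : ℕ :=
  Nat.card {c : G.ConnectedComponent // IsCritical θ (G.induce c.supp)}

/-- `X` is a θ-barrier set: `mult(θ,G) = c_θ(G\X) - |X|`. -/
def IsBarrier (θ : ℝ) (G : SimpleGraph V) (X : Set V) : Prop :=
  numCritComponents θ (deleteSet G X) = mult θ G + X.ncard

/-- `X` is a θ-extreme set: `mult(θ,G\X) = mult(θ,G) + |X|`. -/
def IsExtreme (θ : ℝ) (G : SimpleGraph V) (X : Set V) : Prop :=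
  mult θ (deleteSet G X) = mult θ G + X.ncard

/-- `G` is θ-base: θ-super positive and no θ-barrier set contains two adjacent vertices. -/
def IsBase (θ : ℝ) (G : SimpleGraph V) : Prop :=
  IsSuperPositive θ G ∧
    ∀ X : Set V, IsBarrier θ G X → ∀ u v : V, u ∈ X → v ∈ X → ¬ G.Adj u v

section MatchingPolyOn

open Finset

open Classical in
/-- The matchings of `G` all of whose edges lie inside `A`. -/
noncomputable def matchingsIn (G : SimpleGraph V) (A : Finset V) : Finset (Finset (Sym2 V)) :=
  A.sym2.powerset.filter fun M => (M : Set (Sym2 V)) ⊆ G.edgeSet ∧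
    (M : Set (Sym2 V)).Pairwise fun e f => ∀ v : V, v ∈ e → v ∉ f

/-- The matching polynomial of the subgraph of `G` induced by `A`. -/
noncomputable def matchingPolyOn (G : SimpleGraph V) (A : Finset V) : ℝ[X] :=
  ∑ M ∈ matchingsIn G A, (-1) ^ #M * X ^ (#A - 2 * #M)

theorem mem_matchingsIn {G : SimpleGraph V} {A : Finset V} {M : Finset (Sym2 V)} :
    M ∈ matchingsIn G A ↔ (∀ e ∈ M, ∀ v ∈ e, v ∈ A) ∧ (∀ e ∈ M, e ∈ G.edgeSet) ∧
      ∀ e ∈ M, ∀ f ∈ M, e ≠ f → ∀ v ∈ e, v ∉ f := by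
  classical
  rw [matchingsIn, mem_filter, mem_powerset]
  simp [Finset.subset_iff, Finset.mem_sym2_iff, Set.subset_def, Set.Pairwise]

theorem two_mul_card_le_of_mem_matchingsIn {G : SimpleGraph V} {A : Finset V}
    {M : Finset (Sym2 V)} (hM : M ∈ matchingsIn G A) : 2 * #M ≤ #A := by
  classical
  obtain ⟨hA, hG, hd⟩ := mem_matchingsIn.1 hM
  have hcard : #(M.biUnion Sym2.toFinset) = ∑ e ∈ M, #e.toFinset := by
    refine card_biUnion fun e he f hf hef => ?_
    rw [Function.onFun, Finset.disjoint_left]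
    intro v hv hv'
    exact hd e he f hf hef v (Sym2.mem_toFinset.1 hv) (Sym2.mem_toFinset.1 hv')
  have htwo : ∑ e ∈ M, #e.toFinset = ∑ _e ∈ M, 2 := sum_congr rfl fun e he =>
    Sym2.card_toFinset_of_not_isDiag e (G.not_isDiag_of_mem_edgeSet (hG e he))
  have hsub : M.biUnion Sym2.toFinset ⊆ A := by
    intro v hv
    obtain ⟨e, he, hv⟩ := mem_biUnion.1 hv
    exact hA e he v (Sym2.mem_toFinset.1 hv)
  have := card_le_card hsub
  rw [hcard, htwo, sum_const, smul_eq_mul] at this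
  omega

theorem matchingPoly_eq_matchingPolyOn_univ [Fintype V] (G : SimpleGraph V) :
    matchingPoly G = matchingPolyOn G univ := by
  classical
  have hmaps : ∀ M ∈ matchingsIn G univ, #M ∈ range (Nat.card V + 1) := by
    intro M hM
    have := two_mul_card_le_of_mem_matchingsIn hM
    rw [card_univ] at this
    rw [Nat.card_eq_fintype_card, mem_range]
    omega
  rw [matchingPolyOn, matchingPoly, ← sum_fiberwise_of_maps_to hmaps]
  refine sum_congr rfl fun r _ => ?_
  have hnum : numMatchings G r = #{M ∈ matchingsIn G univ | #M = r} := by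
    rw [numMatchings, ← Nat.card_eq_finsetCard]
    refine Nat.card_congr (Equiv.subtypeEquivRight fun M => ?_)
    rw [mem_filter, mem_matchingsIn]
    simp only [mem_univ, implies_true, true_and]
    exact and_comm
  rw [sum_congr rfl (g := fun _ => (-1) ^ r * X ^ (Nat.card V - 2 * r))]
  · rw [sum_const, hnum, nsmul_eq_mul]
    simp
    ring
  · intro M hM
    rw [(mem_filter.1 hM).2, card_univ, Nat.card_eq_fintype_card]

@[simp]
theorem matchingPolyOn_empty (G : SimpleGraph V) : matchingPolyOn G ∅ = 1 := by
  have : matchingsIn G ∅ = {∅} := by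
    ext M
    rw [mem_matchingsIn, mem_singleton]
    constructor
    · rintro ⟨h, -⟩
      refine eq_empty_of_forall_notMem fun e he => ?_
      induction e with
      | _ a b => simpa using h _ he a (by simp)
    · rintro rfl
      simp
  simp [matchingPolyOn, this]

variable [DecidableEq V]

theorem matchingsIn_eq_union (G : SimpleGraph V) [DecidableRel G.Adj] {A : Finset V} {v : V}
    (hv : v ∈ A) :
    matchingsIn G A = matchingsIn G (A.erase v) ∪
      {w ∈ A | G.Adj v w}.biUnion fun w =>
        (matchingsIn G ((A.erase v).erase w)).image (insert s(v, w)) := by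
  ext M
  simp only [mem_union, mem_biUnion, mem_image, mem_filter]
  constructor
  · intro hM
    obtain ⟨hA, hG, hd⟩ := mem_matchingsIn.1 hM
    by_cases hcov : ∃ e ∈ M, v ∈ e
    · obtain ⟨e, he, hve⟩ := hcov
      obtain ⟨w, rfl⟩ := hve
      refine Or.inr ⟨w, ⟨hA _ he w (by simp), hG _ he⟩, M.erase s(v, w), ?_, insert_erase he⟩
      refine mem_matchingsIn.2 ⟨fun f hf u hu => ?_, fun f hf => hG f (mem_of_mem_erase hf),
        fun f hf g hg => hd f (mem_of_mem_erase hf) g (mem_of_mem_erase hg)⟩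
      obtain ⟨hne, hf⟩ := mem_erase.1 hf
      have hu' := hd f hf _ he hne u hu
      simp only [Sym2.mem_iff, not_or] at hu'
      simp [hu'.1, hu'.2, hA f hf u hu]
    · push Not at hcov
      refine Or.inl (mem_matchingsIn.2 ⟨fun e he u hu => mem_erase.2 ⟨?_, hA e he u hu⟩, hG, hd⟩)
      rintro rfl
      exact hcov e he hu
  · rintro (hM | ⟨w, ⟨hw, hvw⟩, M, hM, rfl⟩)
    · obtain ⟨hA, hG, hd⟩ := mem_matchingsIn.1 hM
      exact mem_matchingsIn.2 ⟨fun e he u hu => mem_of_mem_erase (hA e he u hu), hG, hd⟩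
    · obtain ⟨hA, hG, hd⟩ := mem_matchingsIn.1 hM
      have hdis : ∀ f ∈ M, ∀ u ∈ f, u ∉ s(v, w) := by
        intro f hf u hu
        have := hA f hf u hu
        simp only [mem_erase] at this
        simp [this.1, this.2.1]
      refine mem_matchingsIn.2 ⟨?_, ?_, ?_⟩
      · intro e he u hu
        rcases mem_insert.1 he with rfl | he
        · rcases Sym2.mem_iff.1 hu with rfl | rfl <;> assumption
        · exact mem_of_mem_erase (mem_of_mem_erase (hA e he u hu))
      · intro e he
        rcases mem_insert.1 he with rfl | he
        · exact hvw
        · exact hG e he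
      · intro e he f hf hef u hue huf
        rcases mem_insert.1 he with rfl | he <;> rcases mem_insert.1 hf with rfl | hf
        · exact hef rfl
        · exact hdis f hf u huf hue
        · exact hdis e he u hue huf
        · exact hd e he f hf hef u hue huf

theorem matchingPolyOn_eq_sub_sum (G : SimpleGraph V) [DecidableRel G.Adj] {A : Finset V} {v : V}
    (hv : v ∈ A) :
    matchingPolyOn G A = X * matchingPolyOn G (A.erase v) -
      ∑ w ∈ A.erase v with G.Adj v w, matchingPolyOn G ((A.erase v).erase w) := by
  have hfil : {w ∈ A.erase v | G.Adj v w} = {w ∈ A | G.Adj v w} := by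
    ext w
    simp only [mem_filter, mem_erase]
    exact ⟨fun h => ⟨h.1.2, h.2⟩, fun h => ⟨⟨h.2.ne', h.1⟩, h.2⟩⟩
  have hnot : ∀ {B : Finset V} {w : V} {M : Finset (Sym2 V)}, v ∉ B → M ∈ matchingsIn G B →
      s(v, w) ∉ M := fun hvB hM hmem =>
    hvB ((mem_matchingsIn.1 hM).1 _ hmem v (by simp))
  have hnot' : ∀ {w : V} {M : Finset (Sym2 V)}, M ∈ matchingsIn G ((A.erase v).erase w) →
      ∀ {u : V}, s(v, u) ∉ M := fun hM => hnot (by simp) hM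
  have hAv := card_erase_add_one hv
  rw [hfil]
  conv_lhs => rw [matchingPolyOn, matchingsIn_eq_union G hv]
  rw [sum_union, sum_biUnion, sub_eq_add_neg]
  · congr 1
    · rw [matchingPolyOn, mul_sum]
      refine sum_congr rfl fun M hM => ?_
      have := two_mul_card_le_of_mem_matchingsIn hM
      rw [← hAv, show #(A.erase v) + 1 - 2 * #M = #(A.erase v) - 2 * #M + 1 by omega]
      ring
    · rw [← sum_neg_distrib]
      refine sum_congr rfl fun w hw => ?_
      obtain ⟨hw, hvw⟩ := mem_filter.1 hw
      rw [sum_image, matchingPolyOn, ← sum_neg_distrib]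
      · refine sum_congr rfl fun M hM => ?_
        have hcard := card_erase_add_one (mem_erase.2 ⟨hvw.ne', hw⟩ : w ∈ A.erase v)
        rw [card_insert_of_notMem (hnot' hM), ← hAv, ← hcard,
          show #((A.erase v).erase w) + 1 + 1 - 2 * (#M + 1) = #((A.erase v).erase w) - 2 * #M
            by omega]
        ring
      · intro M hM N hN hMN
        rw [← erase_insert (hnot' hM : s(v, w) ∉ M), hMN, erase_insert (hnot' hN)]
  · intro w _ u _ hwu
    rw [Function.onFun, Finset.disjoint_left]
    intro M hM hM'
    obtain ⟨N, hN, rfl⟩ := mem_image.1 hM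
    obtain ⟨N', hN', hNN'⟩ := mem_image.1 hM'
    have hmem : s(v, w) ∈ insert s(v, u) N' := hNN' ▸ mem_insert_self _ _
    rcases mem_insert.1 hmem with h | h
    · exact hwu (Sym2.congr_right.1 h)
    · exact hnot' hN' h
  · rw [Finset.disjoint_left]
    intro M hM hM'
    obtain ⟨w, _, hM'⟩ := mem_biUnion.1 hM'
    obtain ⟨N, _, rfl⟩ := mem_image.1 hM'
    exact hnot (notMem_erase v A) hM (mem_insert_self _ _)

theorem matchingPolyOn_map {W : Type*} [DecidableEq W] {G : SimpleGraph V} {H : SimpleGraph W}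
    (f : V ↪ W) (hf : ∀ a b, H.Adj (f a) (f b) ↔ G.Adj a b) (A : Finset V) :
    matchingPolyOn H (A.map f) = matchingPolyOn G A := by
  classical
  induction A using Finset.strongInduction with
  | H A ih =>
    rcases A.eq_empty_or_nonempty with rfl | ⟨v, hv⟩
    · simp
    have hlt := erase_ssubset hv
    rw [matchingPolyOn_eq_sub_sum G hv, matchingPolyOn_eq_sub_sum H (mem_map_of_mem f hv),
      ← map_erase, ih _ hlt, filter_map, sum_map]
    congr 1
    refine sum_congr (filter_congr fun w _ => hf v w) fun w _ => ?_
    rw [← map_erase, ih _ ((erase_subset _ _).trans_ssubset hlt)]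

/-- The vertex recurrence, split along a partition of the vertex set. -/
theorem matchingPolyOn_union_eq_sub_sum (G : SimpleGraph V) [DecidableRel G.Adj] {A B : Finset V}
    (hAB : Disjoint A B) {v : V} (hv : v ∈ A) :
    matchingPolyOn G (A ∪ B) = X * matchingPolyOn G (A.erase v ∪ B) -
      ∑ w ∈ A.erase v with G.Adj v w, matchingPolyOn G ((A.erase v).erase w ∪ B) -
      ∑ b ∈ B with G.Adj v b, matchingPolyOn G (A.erase v ∪ B.erase b) := by
  have hA : ∀ w ∈ A, w ∉ B := fun w hw => Finset.disjoint_left.1 hAB hw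
  rw [matchingPolyOn_eq_sub_sum G (mem_union_left B hv), erase_union_distrib,
    erase_eq_of_notMem (hA v hv), filter_union, sum_union, sub_sub]
  · congr 2
    · refine sum_congr rfl fun w hw => ?_
      rw [erase_union_distrib, erase_eq_of_notMem (hA w (mem_of_mem_erase (mem_filter.1 hw).1))]
    · refine sum_congr rfl fun b hb => ?_
      rw [erase_union_distrib, erase_eq_of_notMem (a := b) (s := A.erase v) fun h =>
        hA b (mem_of_mem_erase h) (mem_filter.1 hb).1]
  · exact disjoint_filter_filter (hAB.mono_left (erase_subset _ _))

theorem matchingPolyOn_union {G : SimpleGraph V} {A B : Finset V} (hAB : Disjoint A B)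
    (hadj : ∀ a ∈ A, ∀ b ∈ B, ¬ G.Adj a b) :
    matchingPolyOn G (A ∪ B) = matchingPolyOn G A * matchingPolyOn G B := by
  classical
  induction A using Finset.strongInduction with
  | H A ih =>
    rcases A.eq_empty_or_nonempty with rfl | ⟨v, hv⟩
    · simp
    have hlt := erase_ssubset hv
    have hsub : ∀ A' ⊂ A, matchingPolyOn G (A' ∪ B) = matchingPolyOn G A' * matchingPolyOn G B :=
      fun A' h => ih A' h (hAB.mono_left h.1) fun a ha => hadj a (h.1 ha)
    rw [matchingPolyOn_union_eq_sub_sum G hAB hv, matchingPolyOn_eq_sub_sum G hv, hsub _ hlt,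
      filter_eq_empty_iff.2 fun b hb => hadj v hv b hb, sum_empty, sub_zero, sub_mul, sum_mul,
      mul_assoc]
    congr 1
    exact sum_congr rfl fun w _ => hsub _ ((erase_subset _ _).trans_ssubset hlt)

/-- The expansion along `v` of a weighted sum of one-vertex-deleted matching polynomials. -/
theorem sum_mul_matchingPolyOn_erase (G : SimpleGraph V) [DecidableRel G.Adj] (c : V → ℝ[X])
    {A : Finset V} {v : V} (hv : v ∈ A) :
    ∑ a ∈ A, c a * matchingPolyOn G (A.erase a) = c v * matchingPolyOn G (A.erase v) +
      X * ∑ a ∈ A.erase v, c a * matchingPolyOn G ((A.erase v).erase a) -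
      ∑ w ∈ A.erase v with G.Adj v w, ∑ a ∈ (A.erase v).erase w,
        c a * matchingPolyOn G (((A.erase v).erase w).erase a) := by
  have hswap : ∑ w ∈ A.erase v with G.Adj v w, ∑ a ∈ (A.erase v).erase w,
        c a * matchingPolyOn G (((A.erase v).erase w).erase a) =
      ∑ a ∈ A.erase v, ∑ w ∈ (A.erase v).erase a with G.Adj v w,
        c a * matchingPolyOn G (((A.erase v).erase a).erase w) := by
    refine (sum_comm' (t' := A.erase v)
      (s' := fun a => {w ∈ (A.erase v).erase a | G.Adj v w}) ?_).trans ?_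
    · intro w a
      simp only [mem_filter, mem_erase]
      tauto
    · refine sum_congr rfl fun a _ => sum_congr rfl fun w _ => ?_
      rw [erase_right_comm (a := w)]
  rw [hswap, ← add_sum_erase A _ hv, mul_sum, add_sub_assoc, ← sum_sub_distrib]
  congr 1
  refine sum_congr rfl fun a ha => ?_
  obtain ⟨hav, ha⟩ := mem_erase.1 ha
  rw [matchingPolyOn_eq_sub_sum G (mem_erase.2 ⟨hav.symm, hv⟩ : v ∈ A.erase a),
    erase_right_comm (a := a), mul_sub, mul_sum]
  ring

theorem derivative_matchingPolyOn (G : SimpleGraph V) (A : Finset V) :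
    derivative (matchingPolyOn G A) = ∑ a ∈ A, matchingPolyOn G (A.erase a) := by
  classical
  induction A using Finset.strongInduction with
  | H A ih =>
    rcases A.eq_empty_or_nonempty with rfl | ⟨v, hv⟩
    · simp
    have hlt := erase_ssubset hv
    have h := sum_mul_matchingPolyOn_erase G 1 hv
    simp only [Pi.one_apply, one_mul] at h
    rw [h, matchingPolyOn_eq_sub_sum G hv, derivative_sub, derivative_mul, derivative_X, one_mul,
      derivative_sum, ih _ hlt]
    congr 1
    exact sum_congr rfl fun w _ => ih _ ((erase_subset _ _).trans_ssubset hlt)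

/-- The Heilmann–Lieb inequality. -/
theorem eval_matchingPolyOn_mul_le (G : SimpleGraph V) (x : ℝ) {A : Finset V} {u v : V}
    (hu : u ∈ A) (hv : v ∈ A) (huv : u ≠ v) :
    (matchingPolyOn G A).eval x * (matchingPolyOn G ((A.erase u).erase v)).eval x ≤
      (matchingPolyOn G (A.erase u)).eval x * (matchingPolyOn G (A.erase v)).eval x := by
  classical
  induction A using Finset.strongInduction generalizing u with
  | H A ih =>
    have hlt := erase_ssubset hu
    have hvu : v ∈ A.erase u := mem_erase.2 ⟨huv.symm, hv⟩
    have hAu := congrArg (eval x) (matchingPolyOn_eq_sub_sum G hu)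
    have hAvu := congrArg (eval x)
      (matchingPolyOn_eq_sub_sum G (mem_erase.2 ⟨huv, hu⟩ : u ∈ A.erase v))
    rw [erase_right_comm (a := v)] at hAvu
    simp only [eval_sub, eval_mul, eval_X, eval_finsetSum] at hAu hAvu
    have hterm : ∑ w ∈ (A.erase u).erase v with G.Adj u w,
          (matchingPolyOn G (A.erase u)).eval x *
            (matchingPolyOn G (((A.erase u).erase v).erase w)).eval x ≤
        ∑ w ∈ (A.erase u).erase v with G.Adj u w,
          (matchingPolyOn G ((A.erase u).erase w)).eval x *
            (matchingPolyOn G ((A.erase u).erase v)).eval x := by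
      refine sum_le_sum fun w hw => ?_
      obtain ⟨hwv, hw⟩ := mem_erase.1 (mem_filter.1 hw).1
      rw [erase_right_comm (a := v)]
      exact ih _ hlt hw hvu hwv
    have hsplit : ∑ w ∈ (A.erase u).erase v with G.Adj u w,
          (matchingPolyOn G ((A.erase u).erase w)).eval x *
            (matchingPolyOn G ((A.erase u).erase v)).eval x ≤
        ∑ w ∈ A.erase u with G.Adj u w,
          (matchingPolyOn G ((A.erase u).erase w)).eval x *
            (matchingPolyOn G ((A.erase u).erase v)).eval x := by
      rw [filter_erase]
      by_cases huv' : G.Adj u v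
      · rw [← add_sum_erase _ _ (mem_filter.2 ⟨hvu, huv'⟩)]
        exact le_add_of_nonneg_left (mul_self_nonneg _)
      · rw [erase_eq_of_notMem (by simp [huv'])]
    have := hterm.trans hsplit
    rw [← mul_sum, ← sum_mul] at this
    rw [hAu, hAvu]
    linarith

theorem sq_eval_matchingPolyOn_erase_le (G : SimpleGraph V) (x : ℝ) {A : Finset V} {v : V}
    (hv : v ∈ A) :
    (matchingPolyOn G (A.erase v)).eval x ^ 2 ≤
      (matchingPolyOn G (A.erase v) * derivative (matchingPolyOn G A) -
        derivative (matchingPolyOn G (A.erase v)) * matchingPolyOn G A).eval x := by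
  rw [derivative_matchingPolyOn, derivative_matchingPolyOn, ← add_sum_erase A _ hv]
  simp only [eval_sub, eval_mul, eval_add, eval_finsetSum, mul_add, mul_sum, sum_mul]
  have : ∑ u ∈ A.erase v, (matchingPolyOn G ((A.erase v).erase u)).eval x *
        (matchingPolyOn G A).eval x ≤
      ∑ u ∈ A.erase v, (matchingPolyOn G (A.erase v)).eval x *
        (matchingPolyOn G (A.erase u)).eval x := by
    refine sum_le_sum fun u hu => ?_
    obtain ⟨huv, hu⟩ := mem_erase.1 hu
    rw [mul_comm]
    exact eval_matchingPolyOn_mul_le G x hv hu huv.symm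
  nlinarith

theorem matchingPolyOn_ne_zero (G : SimpleGraph V) (A : Finset V) : matchingPolyOn G A ≠ 0 := by
  induction A using Finset.strongInduction with
  | H A ih =>
    rcases A.eq_empty_or_nonempty with rfl | ⟨v, hv⟩
    · simp
    intro h
    refine ih _ (erase_ssubset hv) (Polynomial.funext fun x => ?_)
    have := sq_eval_matchingPolyOn_erase_le G x hv
    simp only [h, derivative_zero, mul_zero, sub_zero, eval_zero] at this ⊢
    exact pow_eq_zero_iff two_ne_zero |>.1 (le_antisymm this (sq_nonneg _))

theorem pow_dvd_matchingPolyOn_erase {G : SimpleGraph V} {θ : ℝ} {A : Finset V} {v : V} {k : ℕ}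
    (h : (X - C θ) ^ (k + 1) ∣ matchingPolyOn G A) :
    (X - C θ) ^ k ∣ matchingPolyOn G (A.erase v) := by
  by_cases hv : v ∈ A
  swap
  · rw [erase_eq_of_notMem hv]
    exact (pow_dvd_pow _ k.le_succ).trans h
  have h0 := matchingPolyOn_ne_zero G (A.erase v)
  by_contra hk
  rw [← le_rootMultiplicity_iff h0, not_le] at hk
  obtain ⟨q, hq, hdvd⟩ := exists_eq_pow_rootMultiplicity_mul_and_not_dvd _ h0 θ
  set a := (matchingPolyOn G (A.erase v)).rootMultiplicity θ
  obtain ⟨r, hr⟩ := (pow_dvd_pow (X - C θ) (show a + 2 ≤ k + 1 by omega)).trans h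
  obtain ⟨s, hs⟩ : ∃ s : ℝ[X], matchingPolyOn G (A.erase v) * derivative (matchingPolyOn G A) -
      derivative (matchingPolyOn G (A.erase v)) * matchingPolyOn G A =
        (X - C θ) ^ (2 * a) * ((X - C θ) * s) := by
    refine ⟨q * (((a + 2 : ℕ) : ℝ[X]) * r + (X - C θ) * derivative r) -
      ((a : ℝ[X]) * q + (X - C θ) * derivative q) * r, ?_⟩
    rw [hq, hr]
    cases a with
    | zero => simp [derivative_mul, derivative_pow, map_ofNat]; ring
    | succ a => simp [derivative_mul, derivative_pow, map_ofNat]; ring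
  have hle : ∀ x, x ≠ θ → q.eval x ^ 2 ≤ ((X - C θ) * s).eval x := by
    intro x hx
    have := sq_eval_matchingPolyOn_erase_le G x hv
    rw [hs, hq] at this
    simp only [eval_mul, eval_pow, eval_sub, eval_X, eval_C] at this ⊢
    rw [mul_pow, ← pow_mul, mul_comm a 2] at this
    exact le_of_mul_le_mul_left this ((even_two_mul a).pow_pos (sub_ne_zero.2 hx))
  have hle' : ∀ x, (q ^ 2).eval x ≤ ((X - C θ) * s).eval x := by
    have hd : Dense ({θ}ᶜ : Set ℝ) := dense_compl_singleton θ
    intro x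
    have hcl : IsClosed {x | (q ^ 2).eval x ≤ ((X - C θ) * s).eval x} :=
      isClosed_le (Polynomial.continuous _) (Polynomial.continuous _)
    exact hcl.closure_subset_iff.2 (fun y hy => by simpa using hle y hy) (hd x)
  have hθ := hle' θ
  simp only [eval_pow, eval_mul, eval_sub, eval_X, eval_C, sub_self, zero_mul] at hθ
  exact hdvd (dvd_iff_isRoot.2 (pow_eq_zero_iff two_ne_zero |>.1 (le_antisymm hθ (sq_nonneg _))))

theorem pow_dvd_matchingPolyOn_of_erase {G : SimpleGraph V} {θ : ℝ} {A : Finset V} {v : V} {k : ℕ}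
    (h : (X - C θ) ^ (k + 1) ∣ matchingPolyOn G (A.erase v)) :
    (X - C θ) ^ k ∣ matchingPolyOn G A := by
  classical
  have h' := (pow_dvd_pow _ k.le_succ).trans h
  by_cases hv : v ∈ A
  · rw [matchingPolyOn_eq_sub_sum G hv]
    exact dvd_sub (h'.mul_left _) (dvd_sum fun w _ => pow_dvd_matchingPolyOn_erase h)
  · rwa [erase_eq_of_notMem hv] at h'

theorem pow_dvd_matchingPolyOn_of_sdiff {G : SimpleGraph V} {θ : ℝ} {A T : Finset V} {k : ℕ}
    (h : (X - C θ) ^ (k + #T) ∣ matchingPolyOn G (A \ T)) :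
    (X - C θ) ^ k ∣ matchingPolyOn G A := by
  induction T using Finset.induction_on generalizing k with
  | empty => simpa using h
  | insert t T ht ih =>
    rw [card_insert_of_notMem ht, sdiff_insert, ← add_assoc] at h
    exact ih (pow_dvd_matchingPolyOn_of_erase h)

theorem pow_dvd_matchingPolyOn_union_sub {G : SimpleGraph V} {θ : ℝ} {Q T : Finset V}
    (hT : ∀ Y ⊆ T, (X - C θ) ^ #Y ∣ matchingPolyOn G (Q \ Y)) {A Y : Finset V}
    (hAQ : Disjoint A Q) (hadj : ∀ a ∈ A, ∀ b ∈ Q, G.Adj a b → b ∈ T) (hY : Y ⊆ T) :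
    (X - C θ) ^ (#Y + 1) ∣
      matchingPolyOn G (A ∪ Q \ Y) - matchingPolyOn G A * matchingPolyOn G (Q \ Y) := by
  classical
  induction A using Finset.strongInduction generalizing Y with
  | H A ih =>
    rcases A.eq_empty_or_nonempty with rfl | ⟨v, hv⟩
    · simp
    have hlt := erase_ssubset hv
    have hsub : ∀ A' ⊂ A, ∀ {Y : Finset V}, Y ⊆ T → (X - C θ) ^ (#Y + 1) ∣
        matchingPolyOn G (A' ∪ Q \ Y) - matchingPolyOn G A' * matchingPolyOn G (Q \ Y) :=
      fun A' h _ => ih A' h (hAQ.mono_left h.1) fun a ha => hadj a (h.1 ha)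
    have hsplit : matchingPolyOn G (A ∪ Q \ Y) - matchingPolyOn G A * matchingPolyOn G (Q \ Y) =
        X * (matchingPolyOn G (A.erase v ∪ Q \ Y) -
          matchingPolyOn G (A.erase v) * matchingPolyOn G (Q \ Y)) -
        ∑ w ∈ A.erase v with G.Adj v w, (matchingPolyOn G ((A.erase v).erase w ∪ Q \ Y) -
          matchingPolyOn G ((A.erase v).erase w) * matchingPolyOn G (Q \ Y)) -
        ∑ b ∈ Q \ Y with G.Adj v b, matchingPolyOn G (A.erase v ∪ (Q \ Y).erase b) := by
      rw [matchingPolyOn_union_eq_sub_sum G (hAQ.mono_right sdiff_subset) hv,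
        matchingPolyOn_eq_sub_sum G hv, sum_sub_distrib, ← sum_mul]
      ring
    rw [hsplit]
    refine dvd_sub (dvd_sub ((hsub _ hlt hY).mul_left _) (dvd_sum fun w _ =>
      hsub _ ((erase_subset _ _).trans_ssubset hlt) hY)) (dvd_sum fun b hb => ?_)
    obtain ⟨hb, hvb⟩ := mem_filter.1 hb
    obtain ⟨hbQ, hbY⟩ := mem_sdiff.1 hb
    have hbT : insert b Y ⊆ T := insert_subset (hadj v hv b hbQ hvb) hY
    have h₁ := hsub _ hlt hbT
    have h₂ := hT _ hbT
    rw [card_insert_of_notMem hbY] at h₁ h₂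
    rw [← sdiff_insert]
    exact (dvd_sub_left (h₂.mul_left _)).1 ((pow_dvd_pow _ (Nat.le_succ _)).trans h₁)

theorem sq_dvd_matchingPolyOn_union_sub {G : SimpleGraph V} [DecidableRel G.Adj] {θ : ℝ}
    {Q T : Finset V} (hT : ∀ Y ⊆ T, (X - C θ) ^ #Y ∣ matchingPolyOn G (Q \ Y)) {A : Finset V}
    (hAQ : Disjoint A Q) (hadj : ∀ a ∈ A, ∀ b ∈ Q, G.Adj a b → b ∈ T) :
    (X - C θ) ^ 2 ∣ matchingPolyOn G (A ∪ Q) - (matchingPolyOn G A * matchingPolyOn G Q -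
      ∑ a ∈ A, (∑ b ∈ Q with G.Adj a b, matchingPolyOn G (Q.erase b)) *
        matchingPolyOn G (A.erase a)) := by
  induction A using Finset.strongInduction with
  | H A ih =>
    rcases A.eq_empty_or_nonempty with rfl | ⟨v, hv⟩
    · simp
    have hlt := erase_ssubset hv
    set c : V → ℝ[X] := fun a => ∑ b ∈ Q with G.Adj a b, matchingPolyOn G (Q.erase b) with hc
    have hsub : ∀ A' ⊂ A, (X - C θ) ^ 2 ∣ matchingPolyOn G (A' ∪ Q) -
        (matchingPolyOn G A' * matchingPolyOn G Q -
          ∑ a ∈ A', c a * matchingPolyOn G (A'.erase a)) :=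
      fun A' h => ih A' h (hAQ.mono_left h.1) fun a ha => hadj a (h.1 ha)
    have hsplit : matchingPolyOn G (A ∪ Q) - (matchingPolyOn G A * matchingPolyOn G Q -
          ∑ a ∈ A, c a * matchingPolyOn G (A.erase a)) =
        X * (matchingPolyOn G (A.erase v ∪ Q) -
          (matchingPolyOn G (A.erase v) * matchingPolyOn G Q -
            ∑ a ∈ A.erase v, c a * matchingPolyOn G ((A.erase v).erase a))) -
        ∑ w ∈ A.erase v with G.Adj v w, (matchingPolyOn G ((A.erase v).erase w ∪ Q) -
          (matchingPolyOn G ((A.erase v).erase w) * matchingPolyOn G Q -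
            ∑ a ∈ (A.erase v).erase w,
              c a * matchingPolyOn G (((A.erase v).erase w).erase a))) -
        ∑ b ∈ Q with G.Adj v b, (matchingPolyOn G (A.erase v ∪ Q.erase b) -
          matchingPolyOn G (A.erase v) * matchingPolyOn G (Q.erase b)) := by
      rw [matchingPolyOn_union_eq_sub_sum G hAQ hv, matchingPolyOn_eq_sub_sum G hv,
        sum_mul_matchingPolyOn_erase G c hv]
      simp only [sum_sub_distrib]
      rw [← sum_mul, ← mul_sum]
      simp only [hc]
      ring
    change (X - C θ) ^ 2 ∣ _ - (_ - ∑ a ∈ A, c a * _)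
    rw [hsplit]
    refine dvd_sub (dvd_sub ((hsub _ hlt).mul_left _) (dvd_sum fun w _ =>
      hsub _ ((erase_subset _ _).trans_ssubset hlt))) (dvd_sum fun b hb => ?_)
    obtain ⟨hb, hvb⟩ := mem_filter.1 hb
    have := pow_dvd_matchingPolyOn_union_sub hT (Y := {b}) (hAQ.mono_left hlt.1)
      (fun a ha => hadj a (hlt.1 ha)) (singleton_subset_iff.2 (hadj v hv b hb hvb))
    simpa [sdiff_singleton_eq_erase] using this

theorem rootMultiplicity_eq_one_iff {p : ℝ[X]} (hp : p ≠ 0) {θ : ℝ} :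
    p.rootMultiplicity θ = 1 ↔ p.eval θ = 0 ∧ (derivative p).eval θ ≠ 0 := by
  have h₁ := rootMultiplicity_pos hp (x := θ)
  have h₂ := one_lt_rootMultiplicity_iff_isRoot hp (t := θ)
  simp only [IsRoot.def] at h₁ h₂
  constructor
  · intro h
    have := h₁.1 (by omega)
    exact ⟨this, fun h' => by have := h₂.2 ⟨this, h'⟩; omega⟩
  · rintro ⟨h, h'⟩
    have := h₁.2 h
    have : ¬ 1 < p.rootMultiplicity θ := fun hlt => h' (h₂.1 hlt).2
    omega

theorem eval_derivative_erase_mul_nonpos {G : SimpleGraph V} {θ : ℝ} {A : Finset V} {v : V}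
    (hv : v ∈ A) (h : (matchingPolyOn G (A.erase v)).eval θ = 0) :
    (derivative (matchingPolyOn G (A.erase v))).eval θ * (matchingPolyOn G A).eval θ ≤ 0 := by
  have := sq_eval_matchingPolyOn_erase_le G θ hv
  simp only [eval_sub, eval_mul, h] at this
  linarith

theorem eval_matchingPolyOn_union_ne_zero {G : SimpleGraph V} {θ : ℝ} {P Q T : Finset V}
    (hT : ∀ Y ⊆ T, (X - C θ) ^ #Y ∣ matchingPolyOn G (Q \ Y)) (hPQ : Disjoint P Q)
    (hadj : ∀ a ∈ P, ∀ b ∈ Q, G.Adj a b → b ∈ T) (hP : (matchingPolyOn G P).eval θ ≠ 0)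
    (hQ : (matchingPolyOn G Q).eval θ ≠ 0) : (matchingPolyOn G (P ∪ Q)).eval θ ≠ 0 := by
  have h := pow_dvd_matchingPolyOn_union_sub hT hPQ hadj (empty_subset T)
  simp only [card_empty, zero_add, pow_one, sdiff_empty, dvd_iff_isRoot, IsRoot.def, eval_sub,
    eval_mul, sub_eq_zero] at h
  rw [h]
  exact mul_ne_zero hP hQ

theorem rootMultiplicity_matchingPolyOn_erase_union {G : SimpleGraph V} {θ : ℝ} {P Q T : Finset V}
    (hT : ∀ Y ⊆ T, (X - C θ) ^ #Y ∣ matchingPolyOn G (Q \ Y)) (hPQ : Disjoint P Q)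
    (hadj : ∀ a ∈ P, ∀ b ∈ Q, G.Adj a b → b ∈ T) (hP : (matchingPolyOn G P).eval θ ≠ 0)
    (hQ : (matchingPolyOn G Q).eval θ ≠ 0) {v : V} (hv : v ∈ P)
    (hPv : (matchingPolyOn G (P.erase v)).rootMultiplicity θ = 1) :
    (matchingPolyOn G (P.erase v ∪ Q)).rootMultiplicity θ = 1 := by
  classical
  rw [rootMultiplicity_eq_one_iff (matchingPolyOn_ne_zero _ _)] at hPv ⊢
  obtain ⟨hPv, hPv'⟩ := hPv
  have hroot : ∀ b ∈ Q, b ∈ T → (matchingPolyOn G (Q.erase b)).eval θ = 0 := by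
    intro b _ hbT
    have := hT {b} (singleton_subset_iff.2 hbT)
    rwa [card_singleton, pow_one, dvd_iff_isRoot, sdiff_singleton_eq_erase] at this
  have hsum : ∀ a ∈ P, (∑ b ∈ Q with G.Adj a b, matchingPolyOn G (Q.erase b)).eval θ = 0 := by
    intro a ha
    rw [eval_finsetSum]
    refine sum_eq_zero fun b hb => ?_
    obtain ⟨hb, hab⟩ := mem_filter.1 hb
    exact hroot b hb (hadj a ha b hb hab)
  obtain ⟨r, hr⟩ := sq_dvd_matchingPolyOn_union_sub hT (hPQ.mono_left (erase_subset v P))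
    fun a ha => hadj a (mem_of_mem_erase ha)
  rw [sub_eq_iff_eq_add] at hr
  rw [hr]
  simp only [derivative_add, derivative_sub, derivative_sum, derivative_mul, derivative_pow,
    eval_add, eval_sub, eval_mul, eval_pow, eval_finsetSum, eval_X, eval_C, sub_self, hPv]
  have hsum' : ∀ a ∈ P, ∑ b ∈ Q with G.Adj a b, (matchingPolyOn G (Q.erase b)).eval θ = 0 := by
    simpa only [eval_finsetSum] using hsum
  constructor
  · rw [sum_eq_zero fun a ha => by rw [hsum' a (mem_of_mem_erase ha), zero_mul]]
    simp
  · rw [sum_congr rfl fun a ha => by rw [hsum' a (mem_of_mem_erase ha), zero_mul, add_zero]]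
    have hneg : (derivative (matchingPolyOn G (P.erase v))).eval θ *
        (matchingPolyOn G P).eval θ < 0 :=
      (eval_derivative_erase_mul_nonpos hv hPv).lt_of_ne (mul_ne_zero hPv' hP)
    have hnonneg : 0 ≤ (∑ a ∈ P.erase v,
        (∑ b ∈ Q with G.Adj a b, (derivative (matchingPolyOn G (Q.erase b))).eval θ) *
          (matchingPolyOn G ((P.erase v).erase a)).eval θ) *
        ((matchingPolyOn G P).eval θ * (matchingPolyOn G Q).eval θ) := by
      rw [sum_mul]
      refine sum_nonneg fun a ha => ?_
      obtain ⟨hav, ha⟩ := mem_erase.1 ha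
      have h₁ := eval_matchingPolyOn_mul_le G θ hv ha hav.symm
      rw [hPv, zero_mul] at h₁
      have h₂ : (∑ b ∈ Q with G.Adj a b, (derivative (matchingPolyOn G (Q.erase b))).eval θ) *
          (matchingPolyOn G Q).eval θ ≤ 0 := by
        rw [sum_mul]
        refine sum_nonpos fun b hb => ?_
        obtain ⟨hb, hab⟩ := mem_filter.1 hb
        exact eval_derivative_erase_mul_nonpos hb (hroot b hb (hadj a ha b hb hab))
      nlinarith [mul_nonneg_of_nonpos_of_nonpos h₁ h₂]
    intro h
    simp only [zero_mul, mul_zero, add_zero, derivative_C, zero_add, ne_eq, OfNat.ofNat_ne_zero,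
      not_false_eq_true, zero_pow, Nat.add_one_sub_one, pow_one] at h
    have := mul_pos_of_neg_of_neg hneg (neg_neg_of_pos (pow_pos (abs_pos.2 hQ) 2))
    rw [sq_abs] at this
    rw [← sub_eq_zero.1 h] at hnonneg
    linarith

end MatchingPolyOn

section Barrier

open Finset

variable [Fintype V]

theorem mult_eq_zero_iff {θ : ℝ} {G : SimpleGraph V} :
    mult θ G = 0 ↔ (matchingPolyOn G univ).eval θ ≠ 0 := by
  classical
  rw [mult, matchingPoly_eq_matchingPolyOn_univ, rootMultiplicity_eq_zero_iff]
  simp [matchingPolyOn_ne_zero]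

theorem matchingPoly_induce (G : SimpleGraph V) {s : Set V} {A : Finset V}
    (hA : ∀ v, v ∈ A ↔ v ∈ s) : matchingPoly (G.induce s) = matchingPolyOn G A := by
  classical
  have hmap : (univ : Finset s).map (Function.Embedding.subtype (· ∈ s)) = A := by
    ext v
    simp [hA]
  rw [matchingPoly_eq_matchingPolyOn_univ, ← hmap]
  exact (matchingPolyOn_map _ (fun _ _ => Iff.rfl) _).symm

theorem mult_deleteVert [DecidableEq V] (θ : ℝ) (G : SimpleGraph V) (v : V) :
    mult θ (deleteVert G v) = (matchingPolyOn G (univ.erase v)).rootMultiplicity θ := by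
  rw [mult, deleteVert, matchingPoly_induce G (A := univ.erase v) (by simp)]

theorem pow_numCritComponents_dvd (θ : ℝ) (G : SimpleGraph V) :
    (X - C θ) ^ numCritComponents θ G ∣ matchingPolyOn G univ := by
  classical
  have key : ∀ K : Finset G.ConnectedComponent, (∀ c ∈ K, IsCritical θ (G.induce c.supp)) →
      (X - C θ) ^ #K ∣ matchingPolyOn G {v | G.connectedComponentMk v ∈ K} := by
    intro K
    induction K using Finset.induction_on with
    | empty => simp
    | insert c K hc ih =>
      intro hK
      have hsplit : univ.filter (G.connectedComponentMk · ∈ insert c K) =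
          univ.filter (G.connectedComponentMk · = c) ∪ univ.filter (G.connectedComponentMk · ∈ K) := by
        ext v
        simp
      have hdvd : X - C θ ∣ matchingPolyOn G {v | G.connectedComponentMk v = c} := by
        have h := (hK c (mem_insert_self c K)).2
        rw [mult, matchingPoly_induce G (A := {v | G.connectedComponentMk v = c}) (by simp),
          rootMultiplicity_eq_one_iff (matchingPolyOn_ne_zero _ _)] at h
        exact dvd_iff_isRoot.2 h.1
      rw [hsplit, matchingPolyOn_union, card_insert_of_notMem hc, pow_succ']
      · exact mul_dvd_mul hdvd (ih fun c' hc' => hK c' (mem_insert_of_mem hc'))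
      · rw [Finset.disjoint_left]
        intro v hv hv'
        simp only [mem_filter, mem_univ, true_and] at hv hv'
        exact hc (hv ▸ hv')
      · intro a ha b hb hab
        simp only [mem_filter, mem_univ, true_and] at ha hb
        rw [← SimpleGraph.ConnectedComponent.connectedComponentMk_eq_of_adj hab, ha] at hb
        exact hc hb
  set K : Finset G.ConnectedComponent := {c | IsCritical θ (G.induce c.supp)} with hKdef
  have hcard : numCritComponents θ G = #K := by
    rw [numCritComponents, Nat.card_eq_fintype_card, Fintype.card_subtype]
  have hsplit : (univ : Finset V) =
      univ.filter (G.connectedComponentMk · ∈ K) ∪ univ.filter (G.connectedComponentMk · ∉ K) :=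
    (filter_union_filter_not_eq _ _).symm
  rw [hcard, hsplit, matchingPolyOn_union (disjoint_filter_filter_not _ _ _)]
  · exact (key K fun c hc => (mem_filter.1 hc).2).mul_right _
  · intro a ha b hb hab
    simp only [mem_filter, mem_univ, true_and] at ha hb
    rw [SimpleGraph.ConnectedComponent.connectedComponentMk_eq_of_adj hab] at ha
    exact hb (by simpa [hKdef] using ha)

/-- Every subset of a barrier set is extreme. -/
theorem pow_dvd_of_isBarrier [DecidableEq V] {θ : ℝ} {G : SimpleGraph V} {S : Set V}
    (hS : IsBarrier θ G S) {Y : Finset V} (hY : (Y : Set V) ⊆ S) :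
    (X - C θ) ^ #Y ∣ matchingPolyOn G (univ \ Y) := by
  classical
  have hdvd := pow_numCritComponents_dvd θ (deleteSet G S)
  rw [← matchingPoly_eq_matchingPolyOn_univ, deleteSet,
    matchingPoly_induce G (A := univ \ S.toFinset) (by simp)] at hdvd
  have hYS : Y ⊆ S.toFinset := by
    intro y hy
    simpa using hY hy
  have hcard : #Y + #(S.toFinset \ Y) ≤ numCritComponents θ (deleteSet G S) := by
    rw [hS, Set.ncard_eq_toFinset_card', add_comm #Y, card_sdiff_add_card_eq_card hYS]
    exact Nat.le_add_left _ _
  refine pow_dvd_matchingPolyOn_of_sdiff (T := S.toFinset \ Y) ?_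
  rw [sdiff_sdiff_left, sup_eq_union, union_sdiff_of_subset hYS]
  exact (pow_dvd_pow _ hcard).trans hdvd

/-- If all edges between the two parts `G₁` and `G₂` of `G` end in a barrier set of `G₂`, then `G`
behaves like a super positive graph at the vertices of the super positive graph `G₁`. -/
theorem mult_eq_zero_and_mult_deleteVert_of_join {V₁ V₂ : Type*} [Fintype V₁] [Fintype V₂] {θ : ℝ}
    {G : SimpleGraph V} {G₁ : SimpleGraph V₁} {G₂ : SimpleGraph V₂} (f : V₁ ↪ V) (g : V₂ ↪ V)
    (hf : ∀ a b, G.Adj (f a) (f b) ↔ G₁.Adj a b) (hg : ∀ a b, G.Adj (g a) (g b) ↔ G₂.Adj a b)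
    (hfg : IsCompl (Set.range f) (Set.range g)) {S : Set V₂}
    (hadj : ∀ a b, G.Adj (f a) (g b) → b ∈ S) (h₁ : IsSuperPositive θ G₁) (h₂ : mult θ G₂ = 0)
    (hS : IsBarrier θ G₂ S) :
    mult θ G = 0 ∧ ∀ v, mult θ (deleteVert G (f v)) = 1 := by
  classical
  have hdisj : Disjoint (univ.map f) (univ.map g) := by
    rw [← disjoint_coe]
    simpa using hfg.disjoint
  have huniv : (univ : Finset V) = univ.map f ∪ univ.map g := by
    rw [← coe_inj]
    simpa using hfg.sup_eq_top.symm
  have hT : ∀ Y ⊆ S.toFinset.map g, (X - C θ) ^ #Y ∣ matchingPolyOn G (univ.map g \ Y) := by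
    intro Y hY
    obtain ⟨Z, hZ, rfl⟩ := subset_map_iff.1 hY
    rw [card_map, ← Finset.map_sdiff, matchingPolyOn_map g hg]
    refine pow_dvd_of_isBarrier hS fun z hz => ?_
    simpa using hZ hz
  have hadj' : ∀ a ∈ univ.map f, ∀ b ∈ univ.map g, G.Adj a b → b ∈ S.toFinset.map g := by
    simpa using hadj
  have hP : (matchingPolyOn G (univ.map f)).eval θ ≠ 0 := by
    rw [matchingPolyOn_map f hf]
    exact mult_eq_zero_iff.1 h₁.1
  have hQ : (matchingPolyOn G (univ.map g)).eval θ ≠ 0 := by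
    rw [matchingPolyOn_map g hg]
    exact mult_eq_zero_iff.1 h₂
  refine ⟨?_, fun v => ?_⟩
  · rw [mult_eq_zero_iff, huniv]
    exact eval_matchingPolyOn_union_ne_zero hT hdisj hadj' hP hQ
  · have hv : f v ∈ univ.map f := mem_map_of_mem f (mem_univ v)
    rw [mult_deleteVert, huniv, erase_union_distrib,
      erase_eq_of_notMem (Finset.disjoint_left.1 hdisj hv)]
    refine rootMultiplicity_matchingPolyOn_erase_union hT hdisj hadj' hP hQ hv ?_
    rw [← map_erase, matchingPolyOn_map f hf, ← mult_deleteVert]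
    exact h₁.2 v

end Barrier

/-- Joining two θ-super positive graphs by edges between θ-barrier sets S₁ and S₂ yields
a θ-super positive graph. -/
theorem stmt_19 {V₁ V₂ : Type*} [Fintype V₁] [Fintype V₂] (θ : ℝ)
    (G₁ : SimpleGraph V₁) (G₂ : SimpleGraph V₂)
    (h₁ : IsSuperPositive θ G₁) (h₂ : IsSuperPositive θ G₂)
    (S₁ : Set V₁) (S₂ : Set V₂)
    (hS₁ : IsBarrier θ G₁ S₁) (hS₁ne : S₁.Nonempty)
    (hS₂ : IsBarrier θ G₂ S₂) (hS₂ne : S₂.Nonempty)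
    (m : ℕ) (e : Fin m → V₁ × V₂) (he : ∀ j : Fin m, (e j).1 ∈ S₁ ∧ (e j).2 ∈ S₂)
    (G : SimpleGraph (V₁ ⊕ V₂))
    (hG : ∀ x y : V₁ ⊕ V₂, G.Adj x y ↔
      (∃ a b : V₁, x = Sum.inl a ∧ y = Sum.inl b ∧ G₁.Adj a b) ∨
      (∃ a b : V₂, x = Sum.inr a ∧ y = Sum.inr b ∧ G₂.Adj a b) ∨
      (∃ j : Fin m, (x = Sum.inl (e j).1 ∧ y = Sum.inr (e j).2) ∨
        (x = Sum.inr (e j).2 ∧ y = Sum.inl (e j).1))) :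
    IsSuperPositive θ G := by
  have hinl : ∀ a b, G.Adj (Sum.inl a) (Sum.inl b) ↔ G₁.Adj a b := by simp [hG]
  have hinr : ∀ a b, G.Adj (Sum.inr a) (Sum.inr b) ↔ G₂.Adj a b := by simp [hG]
  have hcross : ∀ a b, G.Adj (Sum.inl a) (Sum.inr b) → a ∈ S₁ ∧ b ∈ S₂ := by
    intro a b hab
    obtain ⟨j, rfl, rfl⟩ : ∃ j, a = (e j).1 ∧ b = (e j).2 := by simpa [hG] using hab
    exact he j
  obtain ⟨h, hl⟩ := mult_eq_zero_and_mult_deleteVert_of_join .inl .inr hinl hinr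
    Set.isCompl_range_inl_range_inr (fun a b hab => (hcross a b hab).2) h₁ h₂.1 hS₂
  obtain ⟨-, hr⟩ := mult_eq_zero_and_mult_deleteVert_of_join .inr .inl hinr hinl
    Set.isCompl_range_inl_range_inr.symm (fun b a hab => (hcross a b hab.symm).1) h₂ h₁.1 hS₁
  exact ⟨h, Sum.rec hl hr⟩

end MatchPoly
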